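/- Let f be a complete Bernstein function and let 0 ≤ α ≤ 1. Then the function p ↦ f(p)^α is a complete Bernstein function. -/

import Mathlib

open MeasureTheory Set Filter

/-- A Bernstein function: nonnegative, continuous on `[0,∞)`, smooth on `(0,∞)`,
with `(-1)^{n-1} f⁽ⁿ⁾(x) ≥ 0` for all `x > 0` and all integers `n ≥ 1`. -/
def IsBernstein (f : ℝ → ℝ) : Prop :=
  (∀ x : ℝ, 0 ≤ x → 0 ≤ f x) ∧ ContinuousOn f (Set.Ici 0) ∧
  ContDiffOn ℝ (⊤ : ℕ∞) f (Set.Ioi 0) ∧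
  ∀ n : ℕ, 1 ≤ n → ∀ x : ℝ, 0 < x →
    0 ≤ (-1 : ℝ) ^ (n - 1) * iteratedDerivWithin n f (Set.Ioi 0) x

/-- A complete Bernstein function: `f(x) = x² ∫₀^∞ e^{-xt} g(t) dt` for some Bernstein
function `g`. -/
def IsCBF (f : ℝ → ℝ) : Prop :=
  ∃ g : ℝ → ℝ, IsBernstein g ∧
    ∀ x : ℝ, 0 < x → f x = x ^ 2 * ∫ t in Set.Ioi (0 : ℝ), Real.exp (-x * t) * g t

open scoped Topology NNReal

/-- The kernel `x ↦ x / (x + s)` on `(0,∞)`. -/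
noncomputable def cbfKernel (s : Ioi (0 : ℝ)) : Ioi (0 : ℝ) → ℝ := fun x => (x : ℝ) / (x + s)

/-- The closed convex cone, for pointwise convergence on `(0,∞)`, generated by the functions
`x ↦ x / (x + s)` with `s > 0`. -/
noncomputable def cbfCone : Submodule ℝ≥0 (Ioi (0 : ℝ) → ℝ) :=
  (Submodule.span ℝ≥0 (range cbfKernel)).topologicalClosure

lemma isClosed_cbfCone : IsClosed (cbfCone : Set (Ioi (0 : ℝ) → ℝ)) :=
  Submodule.isClosed_topologicalClosure _

lemma cbfKernel_mem_cbfCone (s : Ioi (0 : ℝ)) : cbfKernel s ∈ cbfCone :=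
  Submodule.le_topologicalClosure _ (Submodule.subset_span ⟨s, rfl⟩)

lemma const_mul_mem_cbfCone {f : Ioi (0 : ℝ) → ℝ} (hf : f ∈ cbfCone) {c : ℝ} (hc : 0 ≤ c) :
    (fun x => c * f x) ∈ cbfCone :=
  cbfCone.smul_mem ⟨c, hc⟩ hf

lemma mem_cbfCone_of_tendsto {ι : Type*} {l : Filter ι} [l.NeBot] {F : ι → Ioi (0 : ℝ) → ℝ}
    {f : Ioi (0 : ℝ) → ℝ} (hF : ∀ᶠ i in l, F i ∈ cbfCone)
    (h : ∀ x, Tendsto (fun i => F i x) l (𝓝 (f x))) : f ∈ cbfCone :=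
  isClosed_cbfCone.mem_of_tendsto (tendsto_pi_nhds.2 h) hF

lemma nonneg_of_mem_cbfCone {f : Ioi (0 : ℝ) → ℝ} (hf : f ∈ cbfCone) (x : Ioi (0 : ℝ)) :
    0 ≤ f x := by
  have hcl : IsClosed {f : Ioi (0 : ℝ) → ℝ | 0 ≤ f x} :=
    isClosed_le continuous_const (continuous_apply x)
  refine closure_minimal ?_ hcl hf
  intro g hg
  induction hg using Submodule.span_induction with
  | mem g hg =>
    obtain ⟨s, rfl⟩ := hg
    have := x.2.out; have := s.2.out
    simp only [mem_ofPred_eq, cbfKernel]; positivity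
  | zero => simp
  | add f g _ _ hf hg => exact add_nonneg (show 0 ≤ f x from hf) (show 0 ≤ g x from hg)
  | smul c f _ hf => exact mul_nonneg c.2 (show 0 ≤ f x from hf)

lemma one_mem_cbfCone : (fun _ => (1 : ℝ)) ∈ cbfCone := by
  refine mem_cbfCone_of_tendsto (l := (atTop : Filter ℕ))
    (F := fun n : ℕ => cbfKernel ⟨1 / ((n : ℝ) + 1), mem_Ioi.2 Nat.one_div_pos_of_nat⟩)
    (Eventually.of_forall fun n => cbfKernel_mem_cbfCone _) fun x => ?_
  have hx := x.2.out
  have h : Tendsto (fun n : ℕ => (x : ℝ) / (x + 1 / ((n : ℝ) + 1))) atTop (𝓝 (x / (x + 0))) :=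
    tendsto_const_nhds.div (tendsto_const_nhds.add tendsto_one_div_add_atTop_nhds_zero_nat)
      (by simpa using hx.ne')
  simpa [cbfKernel, hx.ne'] using h

lemma coe_mem_cbfCone : (fun x : Ioi (0 : ℝ) => (x : ℝ)) ∈ cbfCone := by
  refine mem_cbfCone_of_tendsto (l := (atTop : Filter ℕ))
    (F := fun (n : ℕ) x => ((n : ℝ) + 1) * cbfKernel ⟨(n : ℝ) + 1, mem_Ioi.2 n.cast_add_one_pos⟩ x)
    (Eventually.of_forall fun n => const_mul_mem_cbfCone (cbfKernel_mem_cbfCone _)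
      n.cast_add_one_pos.le) fun x => ?_
  have hx := x.2.out
  have h : Tendsto (fun n : ℕ => (x : ℝ) / (x * (1 / ((n : ℝ) + 1)) + 1)) atTop
      (𝓝 (x / (x * 0 + 1))) :=
    tendsto_const_nhds.div ((tendsto_const_nhds.mul
      tendsto_one_div_add_atTop_nhds_zero_nat).add tendsto_const_nhds) (by simp)
  simp only [mul_zero, zero_add, div_one] at h
  refine h.congr fun n => ?_
  simp only [cbfKernel]
  have : (0 : ℝ) < n + 1 := by positivity
  field_simp

lemma div_affine_mem_cbfCone {b c : ℝ} (hb : 0 ≤ b) (hc : 0 ≤ c) (hbc : 0 < b + c) :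
    (fun x : Ioi (0 : ℝ) => (x : ℝ) / (b + c * x)) ∈ cbfCone := by
  rcases hb.eq_or_lt with rfl | hb
  · convert const_mul_mem_cbfCone one_mem_cbfCone (inv_nonneg.2 hc) using 2 with x
    have := x.2.out
    have : 0 < c := by simpa using hbc
    field_simp; simp
  rcases hc.eq_or_lt with rfl | hc
  · convert const_mul_mem_cbfCone coe_mem_cbfCone (inv_nonneg.2 hb.le) using 2 with x
    rw [zero_mul, add_zero, div_eq_inv_mul]
  · convert const_mul_mem_cbfCone (cbfKernel_mem_cbfCone ⟨b / c, div_pos hb hc⟩)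
      (inv_nonneg.2 hc.le) using 2 with x
    have := x.2.out
    simp only [cbfKernel]
    field_simp
    ring

/-- Rank-one perturbation of a positive diagonal operator: the reciprocal of
`1 + ∑ cᵢ / (x + sᵢ)` is `1 - ∑ wⱼ² / (x + λⱼ)` with positive `λⱼ`. -/
lemma exists_inv_one_add_sum {ι : Type*} [Fintype ι] (v s : ι → ℝ) (hs : ∀ i, 0 < s i) :
    ∃ (n : ℕ) (w l : Fin n → ℝ), (∀ j, 0 < l j) ∧ ∀ x : ℝ, 0 ≤ x →
      (1 + ∑ i, v i ^ 2 / (x + s i)) * (1 - ∑ j, w j ^ 2 / (x + l j)) = 1 := by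
  classical
  let V : EuclideanSpace ℝ ι := WithLp.toLp 2 v
  let T : EuclideanSpace ℝ ι →ₗ[ℝ] EuclideanSpace ℝ ι :=
    { toFun := fun y => WithLp.toLp 2 (fun i => s i * y i + v i * inner ℝ V y)
      map_add' := by
        intro a b; ext i; simp [inner_add_right]; ring
      map_smul' := by
        intro a b; ext i; simp [inner_smul_right]; ring }
  have hinner : ∀ y z : EuclideanSpace ℝ ι, inner ℝ z (T y) = ∑ i, s i * y i * z i + inner ℝ V y * inner ℝ V z := by
    intro y z
    simp only [T, LinearMap.coe_mk, AddHom.coe_mk, PiLp.inner_apply, RCLike.inner_apply,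
      conj_trivial, V, add_mul, Finset.sum_add_distrib]
    congr 1
    rw [Finset.mul_sum]
    exact Finset.sum_congr rfl fun i _ => by ring
  have hT : T.IsSymmetric := by
    intro y z
    rw [real_inner_comm, hinner, hinner, mul_comm (inner ℝ V y)]
    congr 1
    exact Finset.sum_congr rfl fun i _ => by ring
  let e := hT.eigenvectorBasis rfl
  let l := hT.eigenvalues rfl
  have he : ∀ j, T (e j) = l j • e j := fun j => hT.apply_eigenvectorBasis rfl j
  have hl : ∀ j, 0 < l j := by
    intro j
    have h1 : inner ℝ (e j) (T (e j)) = l j := by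
      rw [he, inner_smul_right, real_inner_self_eq_norm_sq, e.orthonormal.1 j]; simp
    rw [← h1, hinner]
    have hne : e j ≠ 0 := e.orthonormal.ne_zero j
    obtain ⟨i, hi⟩ : ∃ i, e j i ≠ 0 := by
      by_contra! h
      exact hne (by ext i; simpa using h i)
    refine add_pos_of_pos_of_nonneg ?_ (mul_self_nonneg _)
    refine Finset.sum_pos' (fun i _ => ?_) ⟨i, Finset.mem_univ _, ?_⟩
    · rw [mul_assoc]; exact mul_nonneg (hs i).le (mul_self_nonneg _)
    · rw [mul_assoc]; exact mul_pos (hs i) (mul_self_pos.2 hi)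
  refine ⟨_, fun j => inner ℝ V (e j), l, hl, fun x hx => ?_⟩
  let y : EuclideanSpace ℝ ι := WithLp.toLp 2 (fun i => v i / (x + s i))
  have hpos : ∀ i, 0 < x + s i := fun i => add_pos_of_nonneg_of_pos hx (hs i)
  set F := ∑ i, v i ^ 2 / (x + s i) with hF
  have hVy : inner ℝ V y = F := by
    simp only [V, y, PiLp.inner_apply, RCLike.inner_apply, conj_trivial, hF]
    exact Finset.sum_congr rfl fun i _ => by ring
  have hTy : x • y + T y = (1 + F) • V := by
    ext i
    have := (hpos i).ne'
    simp only [T, LinearMap.coe_mk, AddHom.coe_mk, PiLp.add_apply, PiLp.smul_apply, smul_eq_mul,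
      hVy]
    simp only [y, V]
    field_simp
    ring
  have hj : ∀ j, inner ℝ (e j) y = (1 + F) * inner ℝ V (e j) / (x + l j) := by
    intro j
    have h1 : inner ℝ (e j) (x • y + T y) = (x + l j) * inner ℝ (e j) y := by
      rw [inner_add_right, inner_smul_right, ← hT (e j) y, he, inner_smul_left]
      simp; ring
    rw [hTy, inner_smul_right, real_inner_comm] at h1
    rw [eq_div_iff (add_pos_of_nonneg_of_pos hx (hl j)).ne', mul_comm, ← h1]
  have hsum : F = (1 + F) * ∑ j, inner ℝ V (e j) ^ 2 / (x + l j) := by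
    rw [Finset.mul_sum]; nth_rw 1 [← hVy]; rw [← e.sum_inner_mul_inner V y]
    exact Finset.sum_congr rfl fun j _ => by rw [hj]; ring
  linear_combination hsum

lemma div_add_mem_cbfCone_of_mem_span {f : Ioi (0 : ℝ) → ℝ}
    (hf : f ∈ Submodule.span ℝ≥0 (range cbfKernel)) :
    (fun x : Ioi (0 : ℝ) => (x : ℝ) / (x + f x)) ∈ cbfCone := by
  obtain ⟨c, rfl⟩ := Finsupp.mem_span_range_iff_exists_finsupp.1 hf
  have hval : ∀ x : Ioi (0 : ℝ), (c.sum fun i a => a • cbfKernel i) x =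
      x * ∑ i : c.support, (√(c i : ℝ)) ^ 2 / ((x : ℝ) + (i : Ioi (0 : ℝ))) := by
    intro x
    rw [Finsupp.sum, Finset.sum_apply, ← Finset.sum_coe_sort, Finset.mul_sum]
    refine Finset.sum_congr rfl fun i _ => ?_
    rw [Real.sq_sqrt (c i).coe_nonneg]
    simp only [Pi.smul_apply, cbfKernel, NNReal.smul_def, smul_eq_mul]
    ring
  obtain ⟨n, w, l, hl, h⟩ := exists_inv_one_add_sum (fun i : c.support => √(c i : ℝ))
    (fun i => ((i : Ioi (0 : ℝ)) : ℝ)) (fun i => i.1.2)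
  have hF : ∀ x : ℝ, 0 ≤ x →
      0 ≤ ∑ i : c.support, (√(c i : ℝ)) ^ 2 / (x + (i : Ioi (0 : ℝ))) := fun x hx =>
    Finset.sum_nonneg fun i _ =>
      div_nonneg (sq_nonneg _) (add_nonneg hx (le_of_lt i.1.2))
  have h0 : 0 ≤ 1 - ∑ j, w j ^ 2 / l j := by
    have h1 := h 0 le_rfl
    have h2 := hF 0 le_rfl
    simp only [zero_add] at h1 h2
    by_contra hneg
    push Not at hneg
    nlinarith
  have hmem : (fun x : Ioi (0 : ℝ) => (1 - ∑ j, w j ^ 2 / l j) * 1) +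
      ∑ j, (fun x : Ioi (0 : ℝ) => (w j ^ 2 / l j) * cbfKernel ⟨l j, hl j⟩ x) ∈ cbfCone :=
    cbfCone.add_mem (const_mul_mem_cbfCone one_mem_cbfCone h0)
      (cbfCone.sum_mem fun j _ => const_mul_mem_cbfCone (cbfKernel_mem_cbfCone _)
        (div_nonneg (sq_nonneg _) (hl j).le))
  convert hmem using 1
  ext x
  have hx := x.2.out
  rw [hval]
  have h1 := h x hx.le
  have h2 := hF x hx.le
  simp only [Pi.add_apply, Finset.sum_apply, cbfKernel, mul_one]
  rw [sub_add, ← Finset.sum_sub_distrib]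
  have h3 : ∀ j, w j ^ 2 / l j - w j ^ 2 / l j * (x / (x + l j)) = w j ^ 2 / (x + l j) := by
    intro j
    have := hl j
    field_simp
    ring
  simp only [h3]
  rw [← mul_one_add, div_mul_cancel_left₀ hx.ne']
  exact inv_eq_of_mul_eq_one_right h1

lemma div_add_mem_cbfCone {f : Ioi (0 : ℝ) → ℝ} (hf : f ∈ cbfCone) :
    (fun x : Ioi (0 : ℝ) => (x : ℝ) / (x + f x)) ∈ cbfCone := by
  have hcont : ContinuousAt (fun (g : Ioi (0 : ℝ) → ℝ) (x : Ioi (0 : ℝ)) =>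
      (x : ℝ) / (x + g x)) f := by
    refine continuousAt_pi.2 fun x => ContinuousAt.div continuousAt_const
      (continuousAt_const.add (continuous_apply x).continuousAt) ?_
    exact (add_pos_of_pos_of_nonneg x.2 (nonneg_of_mem_cbfCone hf x)).ne'
  refine closure_minimal ?_ isClosed_cbfCone (mem_closure_image hcont hf)
  rintro _ ⟨g, hg, rfl⟩
  exact div_add_mem_cbfCone_of_mem_span hg

lemma div_mem_cbfCone {f : Ioi (0 : ℝ) → ℝ} (hf : f ∈ cbfCone) (hpos : ∀ x, 0 < f x) :
    (fun x : Ioi (0 : ℝ) => (x : ℝ) / f x) ∈ cbfCone := by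
  refine mem_cbfCone_of_tendsto (l := (atTop : Filter ℕ))
    (F := fun (n : ℕ) x => ((n : ℝ) + 1) * (x / (x + ((n : ℝ) + 1) * f x)))
    (Eventually.of_forall fun n => const_mul_mem_cbfCone
      (div_add_mem_cbfCone (const_mul_mem_cbfCone hf (by positivity))) (by positivity)) fun x => ?_
  have hx := x.2.out
  have hfx := hpos x
  have h : Tendsto (fun n : ℕ => (x : ℝ) / (x * (1 / ((n : ℝ) + 1)) + f x)) atTop
      (𝓝 (x / (x * 0 + f x))) :=
    tendsto_const_nhds.div ((tendsto_const_nhds.mul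
      tendsto_one_div_add_atTop_nhds_zero_nat).add tendsto_const_nhds) (by simpa using hfx.ne')
  simp only [mul_zero, zero_add] at h
  refine h.congr fun n => ?_
  have : (0 : ℝ) < n + 1 := by positivity
  field_simp

lemma harmonicMean_mem_cbfCone {f g : Ioi (0 : ℝ) → ℝ} (hf : f ∈ cbfCone) (hg : g ∈ cbfCone)
    (hf0 : ∀ x, 0 < f x) (hg0 : ∀ x, 0 < g x) :
    (fun x => 2 * (f x * g x / (f x + g x))) ∈ cbfCone := by
  refine const_mul_mem_cbfCone ?_ zero_le_two
  have h := div_mem_cbfCone (cbfCone.add_mem (div_mem_cbfCone hf hf0) (div_mem_cbfCone hg hg0))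
    (fun x => add_pos (div_pos x.2 (hf0 x)) (div_pos x.2 (hg0 x)))
  convert h using 2 with x
  have := hf0 x; have := hg0 x; have := x.2.out
  simp only [Pi.add_apply]
  field_simp
  ring

/-- The arithmetic-harmonic mean iteration. -/
noncomputable def ahmIter (a b : ℝ) : ℕ → ℝ × ℝ
  | 0 => (a, b)
  | n + 1 => (2⁻¹ * ((ahmIter a b n).1 + (ahmIter a b n).2),
      2 * ((ahmIter a b n).1 * (ahmIter a b n).2 / ((ahmIter a b n).1 + (ahmIter a b n).2)))

lemma ahmIter_pos {a b : ℝ} (ha : 0 < a) (hb : 0 < b) (n : ℕ) :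
    0 < (ahmIter a b n).1 ∧ 0 < (ahmIter a b n).2 := by
  induction n with
  | zero => exact ⟨ha, hb⟩
  | succ n ih =>
    obtain ⟨h1, h2⟩ := ih
    simp only [ahmIter]
    constructor <;> positivity

lemma ahmIter_mul {a b : ℝ} (ha : 0 < a) (hb : 0 < b) (n : ℕ) :
    (ahmIter a b n).1 * (ahmIter a b n).2 = a * b := by
  induction n with
  | zero => rfl
  | succ n ih =>
    obtain ⟨h1, h2⟩ := ahmIter_pos ha hb n
    rw [← ih]
    simp only [ahmIter]
    field_simp

lemma tendsto_ahmIter {a b : ℝ} (ha : 0 < a) (hb : 0 < b) :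
    Tendsto (fun n => (ahmIter a b n).1) atTop (𝓝 √(a * b)) := by
  set r := √(a * b) with hr
  have hr2 : r ^ 2 = a * b := Real.sq_sqrt (by positivity)
  have hr0 : 0 < r := by positivity
  have key : ∀ n, (ahmIter a b (n + 1)).1 - r = ((ahmIter a b n).1 - r) ^ 2 /
      (2 * (ahmIter a b n).1) := by
    intro n
    obtain ⟨h1, h2⟩ := ahmIter_pos ha hb n
    have h3 := ahmIter_mul ha hb n
    have h4 : (ahmIter a b (n + 1)).1 = 2⁻¹ * ((ahmIter a b n).1 + (ahmIter a b n).2) := rfl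
    rw [h4]
    field_simp
    linear_combination h3 - hr2
  have hge : ∀ n, 0 ≤ (ahmIter a b (n + 1)).1 - r := fun n => by
    rw [key]
    have := (ahmIter_pos ha hb n).1
    positivity
  have hle : ∀ n, (ahmIter a b (n + 1)).1 - r ≤ ((ahmIter a b 1).1 - r) * (1 / 2) ^ n := by
    intro n
    induction n with
    | zero => simp
    | succ n ih =>
      have h1 := hge n
      have h2 := (ahmIter_pos ha hb (n + 1)).1
      have h3 : (ahmIter a b (n + 1 + 1)).1 - r ≤ ((ahmIter a b (n + 1)).1 - r) / 2 := by
        rw [key, div_le_div_iff₀ (by positivity) two_pos]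
        nlinarith
      calc _ ≤ ((ahmIter a b (n + 1)).1 - r) / 2 := h3
        _ ≤ _ := by rw [pow_succ]; linarith
  rw [← tendsto_add_atTop_iff_nat 1, tendsto_iff_norm_sub_tendsto_zero]
  have hlim : Tendsto (fun n : ℕ => ((ahmIter a b 1).1 - r) * (1 / 2 : ℝ) ^ n) atTop (𝓝 0) := by
    simpa using (tendsto_pow_atTop_nhds_zero_of_lt_one (r := (1 / 2 : ℝ)) (by norm_num)
      (by norm_num)).const_mul ((ahmIter a b 1).1 - r)
  refine squeeze_zero (fun n => norm_nonneg _) (fun n => ?_) hlim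
  rw [Real.norm_of_nonneg (hge n)]
  exact hle n

lemma sqrt_mul_mem_cbfCone {f g : Ioi (0 : ℝ) → ℝ} (hf : f ∈ cbfCone) (hg : g ∈ cbfCone)
    (hf0 : ∀ x, 0 < f x) (hg0 : ∀ x, 0 < g x) :
    (fun x => √(f x * g x)) ∈ cbfCone := by
  have hmem : ∀ n, (fun x => (ahmIter (f x) (g x) n).1) ∈ cbfCone ∧
      (fun x => (ahmIter (f x) (g x) n).2) ∈ cbfCone := by
    intro n
    induction n with
    | zero => exact ⟨hf, hg⟩
    | succ n ih =>
      exact ⟨const_mul_mem_cbfCone (cbfCone.add_mem ih.1 ih.2) (by norm_num),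
        harmonicMean_mem_cbfCone ih.1 ih.2 (fun x => (ahmIter_pos (hf0 x) (hg0 x) n).1)
          (fun x => (ahmIter_pos (hf0 x) (hg0 x) n).2)⟩
  exact mem_cbfCone_of_tendsto (Eventually.of_forall fun n => (hmem n).1)
    fun x => tendsto_ahmIter (hf0 x) (hg0 x)

lemma rpow_mem_cbfCone_of_pos {f : Ioi (0 : ℝ) → ℝ} (hf : f ∈ cbfCone) (hf0 : ∀ x, 0 < f x)
    {α : ℝ} (hα0 : 0 ≤ α) (hα1 : α ≤ 1) : (fun x => f x ^ α) ∈ cbfCone := by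
  have hdyadic : ∀ n k : ℕ, k ≤ 2 ^ n → (fun x => f x ^ ((k : ℝ) / 2 ^ n)) ∈ cbfCone := by
    intro n
    induction n with
    | zero =>
      intro k hk
      interval_cases k
      · simpa using one_mem_cbfCone
      · simpa using hf
    | succ n ih =>
      intro k hk
      rw [pow_succ] at hk
      have h1 := ih (k / 2) (by lia)
      have h2 := ih (k - k / 2) (by lia)
      convert sqrt_mul_mem_cbfCone h1 h2 (fun x => Real.rpow_pos_of_pos (hf0 x) _)
        (fun x => Real.rpow_pos_of_pos (hf0 x) _) using 2 with x
      rw [← Real.rpow_add (hf0 x), Real.sqrt_eq_rpow, ← Real.rpow_mul (hf0 x).le]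
      congr 1
      rw [Nat.cast_sub (Nat.div_le_self _ _), pow_succ]
      field_simp
      ring
  refine mem_cbfCone_of_tendsto (l := (atTop : Filter ℕ))
    (F := fun (n : ℕ) x => f x ^ ((⌊α * 2 ^ n⌋₊ : ℝ) / 2 ^ n))
    (Eventually.of_forall fun n => hdyadic n _ ?_) fun x => ?_
  · refine Nat.floor_le_of_le ?_
    push_cast
    exact mul_le_of_le_one_left (by positivity) hα1
  · have h1 : Tendsto (fun n : ℕ => (2 : ℝ) ^ n) atTop atTop :=
      tendsto_pow_atTop_atTop_of_one_lt one_lt_two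
    exact (Real.continuousAt_const_rpow (hf0 x).ne').tendsto.comp
      ((tendsto_nat_floor_mul_div_atTop hα0).comp h1)

lemma rpow_mem_cbfCone {f : Ioi (0 : ℝ) → ℝ} (hf : f ∈ cbfCone) {α : ℝ} (hα0 : 0 ≤ α)
    (hα1 : α ≤ 1) : (fun x => f x ^ α) ∈ cbfCone := by
  rcases hα0.eq_or_lt with rfl | hα
  · simpa using one_mem_cbfCone
  have hpos : ∀ (n : ℕ) (x : Ioi (0 : ℝ)), 0 < f x + 1 / ((n : ℝ) + 1) * 1 := fun n x =>
    add_pos_of_nonneg_of_pos (nonneg_of_mem_cbfCone hf x) (by positivity)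
  refine mem_cbfCone_of_tendsto (l := (atTop : Filter ℕ))
    (F := fun (n : ℕ) x => (f x + 1 / ((n : ℝ) + 1) * 1) ^ α)
    (Eventually.of_forall fun n => rpow_mem_cbfCone_of_pos (cbfCone.add_mem hf
      (const_mul_mem_cbfCone one_mem_cbfCone (by positivity))) (hpos n) hα0 hα1) fun x => ?_
  have h : Tendsto (fun n : ℕ => f x + 1 / ((n : ℝ) + 1) * 1) atTop (𝓝 (f x)) := by
    simpa using (tendsto_one_div_add_atTop_nhds_zero_nat (𝕜 := ℝ)).const_add (f x)
  exact h.rpow_const (Or.inr hα0)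

lemma sum_choose_mul_choose_mul_pow {R : Type*} [CommRing R] (x : R) {n j : ℕ} (hj : j ≤ n) :
    ∑ k ∈ Finset.range (n + 1), ((n.choose k * k.choose j : ℕ) : R) * (x ^ k * (1 - x) ^ (n - k)) =
      (n.choose j : R) * x ^ j := by
  obtain ⟨m, rfl⟩ := Nat.exists_eq_add_of_le hj
  have h0 : ∑ k ∈ Finset.range j, (((j + m).choose k * k.choose j : ℕ) : R) *
      (x ^ k * (1 - x) ^ (j + m - k)) = 0 := by
    refine Finset.sum_eq_zero fun k hk => ?_
    rw [Nat.choose_eq_zero_of_lt (Finset.mem_range.1 hk)]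
    simp
  have h1 : x ^ j = x ^ j * (x + (1 - x)) ^ m := by simp
  rw [add_assoc, Finset.sum_range_add, h0, zero_add, h1, add_pow, Finset.mul_sum, Finset.mul_sum]
  refine Finset.sum_congr rfl fun i hi => ?_
  have hi' : i ≤ m := Nat.lt_succ_iff.1 (Finset.mem_range.1 hi)
  have h2 := Nat.choose_mul (n := j + m) (k := j + i) (s := j) (by lia)
  rw [h2, Nat.add_sub_cancel_left, Nat.add_sub_cancel_left,
    show j + m - (j + i) = m - i by lia]
  push_cast
  ring

/-- A sequence is recovered from its iterated differences along an antidiagonal. -/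
lemma choose_mul_eq_sum_difference {d : ℕ → ℕ → ℝ} (hd : ∀ m k, d (m + 1) k = d m k - d m (k + 1))
    {n j : ℕ} (hj : j ≤ n) :
    (n.choose j : ℝ) * d 0 j =
      ∑ k ∈ Finset.range (n + 1), (n.choose k * d (n - k) k) * (k.choose j : ℝ) := by
  let L : Polynomial ℝ →ₗ[ℝ] ℝ := Polynomial.lsum fun k => (d 0 k) • LinearMap.id
  have hL : ∀ m k, L (Polynomial.X ^ k * (1 - Polynomial.X) ^ m) = d m k := by
    intro m
    induction m with
    | zero =>
      intro k
      simp [L, Polynomial.lsum_apply, ← Polynomial.monomial_one_right_eq_X_pow,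
        Polynomial.sum_monomial_index]
    | succ m ih =>
      intro k
      rw [hd, ← ih, ← ih, ← map_sub]
      congr 1
      ring
  have h := congrArg L (sum_choose_mul_choose_mul_pow (Polynomial.X : Polynomial ℝ) hj)
  have h2 : ∀ (c : ℕ) p, L ((c : Polynomial ℝ) * p) = c * L p := by
    intro c p
    rw [← nsmul_eq_mul, map_nsmul, nsmul_eq_mul]
  have h3 := hL 0 j
  rw [pow_zero, mul_one] at h3
  rw [map_sum, h2, h3] at h
  rw [← h]
  refine Finset.sum_congr rfl fun k _ => ?_
  rw [h2, hL]
  push_cast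
  ring

lemma choose_div_choose_mem {n k j : ℕ} (hj : j ≤ n) (hk : k ≤ n) :
    (k.choose j : ℝ) / n.choose j ∈ Icc (0 : ℝ) 1 := by
  have h : (0 : ℝ) < n.choose j := by exact_mod_cast Nat.choose_pos hj
  refine ⟨by positivity, (div_le_one h).2 ?_⟩
  exact_mod_cast Nat.choose_le_choose j hk

lemma abs_choose_div_choose_sub_pow_le {n k j : ℕ} (hn : 0 < n) (hj : j ≤ n) (hk : k ≤ n) :
    |(k.choose j : ℝ) / n.choose j - ((k : ℝ) / n) ^ j| ≤ (j : ℝ) ^ 2 / n := by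
  have hn' : (0 : ℝ) < n := by exact_mod_cast hn
  have hkn : (k : ℝ) / n ≤ 1 := (div_le_one hn').2 (by exact_mod_cast hk)
  have hkn0 : 0 ≤ (k : ℝ) / n := by positivity
  induction j with
  | zero => simp
  | succ j ih =>
    have hjn : j < n := hj
    have ih := ih hjn.le
    obtain ⟨hd0, hd1⟩ := choose_div_choose_mem hjn.le hk
    have hnj : (0 : ℝ) < n - j := sub_pos.2 (by exact_mod_cast hjn)
    have hcj : (0 : ℝ) < n.choose j := by exact_mod_cast Nat.choose_pos hjn.le
    have hcj1 : (0 : ℝ) < n.choose (j + 1) := by exact_mod_cast Nat.choose_pos hj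
    have e1 : (n.choose (j + 1) : ℝ) * (j + 1) = n.choose j * (n - j) := by
      have := Nat.choose_succ_right_eq n j
      rw [← Nat.cast_sub hjn.le]
      exact_mod_cast this
    by_cases hkj : k < j
    · have hlt : (k : ℝ) < j := by exact_mod_cast hkj
      rw [Nat.choose_eq_zero_of_lt hkj] at ih
      rw [Nat.choose_eq_zero_of_lt (by lia : k < j + 1)]
      simp only [Nat.cast_zero, zero_div, zero_sub, abs_neg] at ih ⊢
      rw [abs_of_nonneg (by positivity)] at ih ⊢
      calc ((k : ℝ) / n) ^ (j + 1) ≤ ((k : ℝ) / n) ^ j :=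
            pow_le_pow_of_le_one hkn0 hkn (Nat.le_succ j)
        _ ≤ (j : ℝ) ^ 2 / n := ih
        _ ≤ ((j + 1 : ℕ) : ℝ) ^ 2 / n := by gcongr; simp
    · push Not at hkj
      have hjk : (j : ℝ) ≤ k := by exact_mod_cast hkj
      have hkn2 : (k : ℝ) ≤ n := by exact_mod_cast hk
      have e2 : (k.choose (j + 1) : ℝ) * (j + 1) = k.choose j * (k - j) := by
        have := Nat.choose_succ_right_eq k j
        rw [← Nat.cast_sub hkj]
        exact_mod_cast this
      have e3 : (k.choose (j + 1) : ℝ) / n.choose (j + 1) =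
          (k.choose j / n.choose j) * ((k - j) / (n - j)) := by
        rw [div_mul_div_comm, ← e1, ← e2, mul_div_mul_right _ _ (by positivity)]
      have e4 : |((k : ℝ) - j) / (n - j) - k / n| ≤ j / n := by
        have : ((k : ℝ) - j) / (n - j) - k / n = - (j / n * ((n - k) / (n - j))) := by
          field_simp
          ring
        rw [this, abs_neg, abs_of_nonneg (mul_nonneg (by positivity)
          (div_nonneg (sub_nonneg.2 hkn2) hnj.le))]
        exact mul_le_of_le_one_right (by positivity) ((div_le_one hnj).2 (by linarith))
      set δ := (k.choose j : ℝ) / n.choose j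
      set r := (k : ℝ) / n
      have e5 : δ * (((k : ℝ) - j) / (n - j)) - r ^ (j + 1) =
          δ * (((k : ℝ) - j) / (n - j) - r) + (δ - r ^ j) * r := by ring
      rw [e3, e5]
      calc _ ≤ |δ * (((k : ℝ) - j) / (n - j) - r)| + |(δ - r ^ j) * r| := abs_add_le _ _
        _ ≤ j / n + j ^ 2 / n := by
          rw [abs_mul, abs_mul, abs_of_nonneg hd0, abs_of_nonneg hkn0]
          gcongr
          · exact (mul_le_of_le_one_left (abs_nonneg _) hd1).trans e4
          · exact (mul_le_of_le_one_right (abs_nonneg _) hkn).trans ih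
        _ ≤ ((j + 1 : ℕ) : ℝ) ^ 2 / n := by
          rw [← add_div]
          gcongr
          push_cast
          nlinarith [(Nat.cast_nonneg j : (0 : ℝ) ≤ j)]

/-- The weights of the discrete measures approximating the representing measure of a completely
monotone sequence reproduce its generating function in the limit. -/
lemma tendsto_sum_choose_mul_div {d : ℕ → ℕ → ℝ} (hd : ∀ m k, d (m + 1) k = d m k - d m (k + 1))
    (hd0 : ∀ m k, 0 ≤ d m k) {q : ℝ} (hq0 : 0 < q) (hq1 : q < 1) :
    Tendsto (fun n : ℕ => ∑ k ∈ Finset.range (n + 1),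
      (n.choose k * d (n - k) k) * (1 / (1 - (k : ℝ) / n * q))) atTop
      (𝓝 (∑' j, d 0 j * q ^ j)) := by
  have hw0 : ∀ n k : ℕ, 0 ≤ (n.choose k : ℝ) * d (n - k) k := fun n k =>
    mul_nonneg (Nat.cast_nonneg _) (hd0 _ _)
  have hsum : ∀ n : ℕ, ∑ k ∈ Finset.range (n + 1), ((n.choose k : ℝ) * d (n - k) k) = d 0 0 := by
    intro n
    simpa using (choose_mul_eq_sum_difference hd (Nat.zero_le n)).symm
  have hr : ∀ {n k : ℕ}, k ∈ Finset.range (n + 1) → 0 ≤ (k : ℝ) / n ∧ (k : ℝ) / n ≤ 1 := by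
    intro n k hk
    refine ⟨by positivity, div_le_one_of_le₀ ?_ (Nat.cast_nonneg _)⟩
    exact_mod_cast Nat.lt_succ_iff.1 (Finset.mem_range.1 hk)
  have hmom : ∀ n j : ℕ, |∑ k ∈ Finset.range (n + 1), (n.choose k * d (n - k) k) *
      ((k : ℝ) / n) ^ j| ≤ d 0 0 := by
    intro n j
    rw [← hsum n]
    refine (Finset.abs_sum_le_sum_abs _ _).trans (Finset.sum_le_sum fun k hk => ?_)
    obtain ⟨h0, h1⟩ := hr hk
    rw [abs_of_nonneg (mul_nonneg (hw0 _ _) (pow_nonneg h0 _))]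
    exact mul_le_of_le_one_right (hw0 _ _) (pow_le_one₀ h0 h1)
  have hgeo : ∀ n : ℕ, ∑ k ∈ Finset.range (n + 1),
      (n.choose k * d (n - k) k) * (1 / (1 - (k : ℝ) / n * q)) =
      ∑' j, (∑ k ∈ Finset.range (n + 1), (n.choose k * d (n - k) k) *
      ((k : ℝ) / n) ^ j) * q ^ j := by
    intro n
    refine (HasSum.tsum_eq ?_).symm
    simp_rw [Finset.sum_mul]
    refine hasSum_sum fun k hk => ?_
    obtain ⟨h0, h1⟩ := hr hk
    simp_rw [mul_assoc, ← mul_pow]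
    simp only [← mul_assoc, one_div]
    exact (hasSum_geometric_of_lt_one (mul_nonneg h0 hq0.le)
      ((mul_le_of_le_one_left hq0.le h1).trans_lt hq1)).mul_left _
  simp_rw [hgeo]
  refine tendsto_tsum_of_dominated_convergence (bound := fun j => d 0 0 * q ^ j)
    ((summable_geometric_of_lt_one hq0.le hq1).mul_left _) (fun j => ?_)
    (Eventually.of_forall fun n j => ?_)
  · refine Tendsto.mul_const _ ?_
    rw [tendsto_iff_norm_sub_tendsto_zero]
    have hlim : Tendsto (fun n : ℕ => d 0 0 * ((j : ℝ) ^ 2 / n)) atTop (𝓝 0) := by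
      simpa using (tendsto_const_div_atTop_nhds_zero_nat ((j : ℝ) ^ 2)).const_mul (d 0 0)
    refine squeeze_zero' (Eventually.of_forall fun n => norm_nonneg _) ?_ hlim
    filter_upwards [eventually_ge_atTop j, eventually_gt_atTop 0] with n hnj hn
    have hc : (n.choose j : ℝ) ≠ 0 := by exact_mod_cast (Nat.choose_pos hnj).ne'
    have e : d 0 j = ∑ k ∈ Finset.range (n + 1), (n.choose k * d (n - k) k) *
        ((k.choose j : ℝ) / n.choose j) := by
      rw [← mul_right_inj' hc, choose_mul_eq_sum_difference hd hnj, Finset.mul_sum]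
      refine Finset.sum_congr rfl fun k _ => ?_
      field_simp
    rw [e, ← Finset.sum_sub_distrib, ← hsum n, Finset.sum_mul, Real.norm_eq_abs]
    refine (Finset.abs_sum_le_sum_abs _ _).trans (Finset.sum_le_sum fun k hk => ?_)
    rw [← mul_sub, abs_mul, abs_of_nonneg (hw0 _ _), abs_sub_comm]
    exact mul_le_mul_of_nonneg_left (abs_choose_div_choose_sub_pow_le hn hnj
      (Nat.lt_succ_iff.1 (Finset.mem_range.1 hk))) (hw0 _ _)
  · rw [norm_mul, Real.norm_eq_abs, Real.norm_of_nonneg (pow_nonneg hq0.le j)]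
    exact mul_le_mul_of_nonneg_right (hmom n j) (pow_nonneg hq0.le j)

lemma differences_nonneg_of_hasDerivAt {h : ℝ} (hh : 0 ≤ h) (m : ℕ) :
    ∀ {F : ℕ → ℝ → ℝ}, (∀ n t, 0 < t → HasDerivAt (F n) (F (n + 1) t) t) →
      (∀ n t, 0 < t → 0 ≤ (-1) ^ n * F n t) → ∀ {d : ℕ → ℝ → ℝ}, d 0 = F 0 →
      (∀ m t, d (m + 1) t = d m t - d m (t + h)) → ∀ t, 0 < t → 0 ≤ d m t := by
  induction m with
  | zero =>
    intro F hF hF0 d hd0 hd t ht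
    simpa [hd0] using hF0 0 t ht
  | succ m ih =>
    intro F hF hF0 d hd0 hd t ht
    refine ih (F := fun n t => F n t - F n (t + h)) (d := fun m => d (m + 1)) ?_ ?_ ?_ ?_ t ht
    · intro n t ht
      exact (hF n t ht).sub ((hF n (t + h) (by linarith)).comp_add_const t h)
    · intro n t ht
      have hanti : AntitoneOn (fun t => (-1) ^ n * F n t) (Ioi 0) := by
        have hder : ∀ t ∈ Ioi (0 : ℝ), HasDerivAt (fun t => (-1) ^ n * F n t)
            ((-1) ^ n * F (n + 1) t) t := fun t ht => (hF n t ht).const_mul _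
        refine antitoneOn_of_deriv_nonpos (convex_Ioi 0)
          (fun t ht => (hder t ht).continuousAt.continuousWithinAt)
          (fun t ht => ?_) fun t ht => ?_ <;> rw [interior_Ioi] at ht
        · exact (hder t ht).differentiableAt.differentiableWithinAt
        · rw [(hder t ht).deriv]
          have := hF0 (n + 1) t ht
          rw [pow_succ] at this
          linarith
      have := hanti (mem_Ioi.2 ht) (mem_Ioi.2 (by linarith : 0 < t + h)) (by linarith)
      simp only at this
      rw [mul_sub]
      linarith
    · funext t
      rw [hd, hd0]
    · intro m t
      exact hd (m + 1) t

lemma IsBernstein.hasDerivAt {g : ℝ → ℝ} (hg : IsBernstein g) (n : ℕ) {t : ℝ} (ht : 0 < t) :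
    HasDerivAt (iteratedDerivWithin n g (Ioi 0)) (iteratedDerivWithin (n + 1) g (Ioi 0) t) t := by
  have hd := hg.2.2.1.differentiableOn_iteratedDerivWithin (m := n)
    (by exact_mod_cast WithTop.coe_lt_top _) (uniqueDiffOn_Ioi 0)
  have h := (hd t ht).hasDerivWithinAt.hasDerivAt (Ioi_mem_nhds ht)
  rwa [← iteratedDerivWithin_succ] at h

lemma IsBernstein.monotoneOn {g : ℝ → ℝ} (hg : IsBernstein g) : MonotoneOn g (Ici 0) := by
  refine monotoneOn_of_deriv_nonneg (convex_Ici 0) hg.2.1 (fun t ht => ?_) fun t ht => ?_ <;>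
    rw [interior_Ici] at ht <;> have h := hg.hasDerivAt 0 ht <;> rw [iteratedDerivWithin_zero] at h
  · exact h.differentiableAt.differentiableWithinAt
  · rw [h.deriv]
    simpa using hg.2.2.2 1 le_rfl t ht

lemma IsBernstein.antitoneOn_deriv {g : ℝ → ℝ} (hg : IsBernstein g) :
    AntitoneOn (iteratedDerivWithin 1 g (Ioi 0)) (Ioi 0) := by
  refine antitoneOn_of_deriv_nonpos (convex_Ioi 0)
    (fun t ht => (hg.hasDerivAt 1 ht).continuousAt.continuousWithinAt)
    (fun t ht => ?_) fun t ht => ?_ <;> rw [interior_Ioi] at ht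
  · exact (hg.hasDerivAt 1 ht).differentiableAt.differentiableWithinAt
  · rw [(hg.hasDerivAt 1 ht).deriv]
    simpa using hg.2.2.2 2 (by norm_num) t ht

lemma IsBernstein.exists_le {g : ℝ → ℝ} (hg : IsBernstein g) :
    ∃ C, 0 ≤ C ∧ ∀ t, 0 ≤ t → g t ≤ C * (1 + t) := by
  have hc : 0 ≤ iteratedDerivWithin 1 g (Ioi 0) 1 := by
    simpa using hg.2.2.2 1 le_rfl 1 one_pos
  have h1 : 0 ≤ g 1 := hg.1 1 zero_le_one
  set c := iteratedDerivWithin 1 g (Ioi 0) 1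
  refine ⟨g 1 + c, by positivity, fun t ht => ?_⟩
  rcases le_total t 1 with h | h
  · have := hg.monotoneOn ht (zero_le_one : (0 : ℝ) ≤ 1) h
    nlinarith
  · have hder : ∀ s, 0 < s → HasDerivAt g (iteratedDerivWithin 1 g (Ioi 0) s) s := by
      intro s hs
      simpa [iteratedDerivWithin_zero] using hg.hasDerivAt 0 hs
    have := (convex_Ici (1 : ℝ)).image_sub_le_mul_sub_of_deriv_le (f := g) (C := c)
      (fun s hs => (hder s (zero_lt_one.trans_le hs)).continuousAt.continuousWithinAt)
      (fun s hs => by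
        rw [interior_Ici] at hs
        exact (hder s (zero_lt_one.trans hs)).differentiableAt.differentiableWithinAt)
      (fun s hs => by
        rw [interior_Ici] at hs
        rw [(hder s (zero_lt_one.trans hs)).deriv]
        exact hg.antitoneOn_deriv (mem_Ioi.2 one_pos) (mem_Ioi.2 (zero_lt_one.trans hs)) hs.le)
      1 (mem_Ici.2 le_rfl) t h h
    nlinarith

/-- The increments of a Bernstein function over an arithmetic progression form a completely
monotone sequence. -/
lemma IsBernstein.exists_differences {g : ℝ → ℝ} (hg : IsBernstein g) {h : ℝ} (hh : 0 < h) :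
    ∃ d : ℕ → ℕ → ℝ, (∀ k, d 0 k = g (((k + 1 : ℕ) : ℝ) * h) - g (k * h)) ∧
      (∀ m k, d (m + 1) k = d m k - d m (k + 1)) ∧ ∀ m k, 0 ≤ d m k := by
  let e : ℕ → ℝ → ℝ := fun m => Nat.rec (fun t => g (t + h) - g t)
    (fun _ u t => u t - u (t + h)) m
  have he0 : ∀ t, e 0 t = g (t + h) - g t := fun t => rfl
  have he : ∀ m t, e (m + 1) t = e m t - e m (t + h) := fun m t => rfl
  have hnonneg : ∀ m t, 0 < t → 0 ≤ e m t := by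
    intro m
    refine differences_nonneg_of_hasDerivAt hh.le m
      (F := fun n t => iteratedDerivWithin n g (Ioi 0) (t + h) - iteratedDerivWithin n g (Ioi 0) t)
      ?_ ?_ ?_ he
    · intro n t ht
      exact ((hg.hasDerivAt n (by linarith : 0 < t + h)).comp_add_const t h).sub (hg.hasDerivAt n ht)
    · intro n t ht
      have hder : ∀ t ∈ Ioi (0 : ℝ), HasDerivAt (fun t => (-1) ^ n * iteratedDerivWithin n g (Ioi 0) t)
          ((-1) ^ n * iteratedDerivWithin (n + 1) g (Ioi 0) t) t :=
        fun t ht => (hg.hasDerivAt n ht).const_mul _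
      have hmono : MonotoneOn (fun t => (-1) ^ n * iteratedDerivWithin n g (Ioi 0) t) (Ioi 0) := by
        refine monotoneOn_of_deriv_nonneg (convex_Ioi 0)
          (fun t ht => (hder t ht).continuousAt.continuousWithinAt)
          (fun t ht => ?_) fun t ht => ?_ <;> rw [interior_Ioi] at ht
        · exact (hder t ht).differentiableAt.differentiableWithinAt
        · rw [(hder t ht).deriv]
          simpa using hg.2.2.2 (n + 1) (by lia) t ht
      have := hmono (mem_Ioi.2 ht) (mem_Ioi.2 (by linarith : 0 < t + h)) (by linarith)
      simp only at this
      rw [mul_sub]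
      linarith
    · funext t
      simp [e]
  have hcont : ∀ m, ContinuousOn (e m) (Ici 0) := by
    have hmaps : MapsTo (fun t : ℝ => t + h) (Ici 0) (Ici 0) := fun t ht =>
      mem_Ici.2 (add_nonneg ht hh.le)
    have hadd : ContinuousOn (fun t : ℝ => t + h) (Ici 0) := by fun_prop
    intro m
    induction m with
    | zero => exact (hg.2.1.comp hadd hmaps).sub hg.2.1
    | succ m ih => exact ih.sub (ih.comp hadd hmaps)
  have hnonneg' : ∀ m t, 0 ≤ t → 0 ≤ e m t := by
    intro m t ht
    rcases ht.eq_or_lt with rfl | ht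
    · have h1 : Tendsto (e m) (𝓝[>] 0) (𝓝 (e m 0)) :=
        ((hcont m) 0 (mem_Ici.2 le_rfl)).mono_left (nhdsWithin_mono _ Ioi_subset_Ici_self)
      exact ge_of_tendsto h1 (eventually_nhdsWithin_of_forall fun t ht => hnonneg m t ht)
    · exact hnonneg m t ht
  refine ⟨fun m k => e m (k * h), fun k => ?_, fun m k => ?_, fun m k => hnonneg' m _ (by positivity)⟩
  · simp only [he0]
    push_cast
    ring_nf
  · simp only [he]
    push_cast
    ring_nf

lemma IsBernstein.integrableOn_exp_mul {g : ℝ → ℝ} (hg : IsBernstein g) {x : ℝ} (hx : 0 < x) :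
    IntegrableOn (fun t => Real.exp (-x * t) * g t) (Ioi 0) := by
  obtain ⟨C, hC, hgC⟩ := hg.exists_le
  have h1 : IntegrableOn (fun t => Real.exp (-x * t)) (Ioi 0) :=
    integrableOn_exp_mul_Ioi (neg_lt_zero.2 hx) 0
  have h2 : IntegrableOn (fun t : ℝ => t * Real.exp (-x * t)) (Ioi 0) := by
    simpa using integrableOn_rpow_mul_exp_neg_mul_rpow (s := 1) (p := 1) (by norm_num)
      (by norm_num) hx
  refine ((h1.add h2).const_mul C).mono' ?_ ?_
  · refine ContinuousOn.aestronglyMeasurable ?_ measurableSet_Ioi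
    exact (Continuous.continuousOn (by fun_prop)).mul (hg.2.1.mono Ioi_subset_Ici_self)
  · refine (ae_restrict_iff' measurableSet_Ioi).2 (Eventually.of_forall fun t ht => ?_)
    have ht : 0 < t := ht
    rw [Real.norm_of_nonneg (mul_nonneg (Real.exp_pos _).le (hg.1 t ht.le))]
    simp only [Pi.add_apply]
    have := mul_le_mul_of_nonneg_left (hgC t ht.le) (Real.exp_pos (-x * t)).le
    linarith

/-- The step function whose integral is a Riemann sum of `exp (-x t) * g t`. -/
noncomputable def laplaceStep (g : ℝ → ℝ) (x : ℝ) (N : ℕ) (t : ℝ) : ℝ :=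
  (1 - x / N) ^ ⌊t * N⌋₊ * g (⌊t * N⌋₊ * (N : ℝ)⁻¹)

lemma measurable_laplaceStep (g : ℝ → ℝ) (x : ℝ) (N : ℕ) : Measurable (laplaceStep g x N) := by
  have h : Measurable (fun t : ℝ => ⌊t * N⌋₊) := Nat.measurable_floor.comp (by fun_prop)
  exact (measurable_of_countable fun m : ℕ => (1 - x / N) ^ m * g (m * (N : ℝ)⁻¹)).comp h

lemma IsBernstein.norm_laplaceStep_le {g : ℝ → ℝ} (hg : IsBernstein g) {x : ℝ} (hx : 0 < x) {N : ℕ}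
    (hN : x < N) {t : ℝ} (ht : 0 < t) :
    ‖laplaceStep g x N t‖ ≤ Real.exp 1 * (Real.exp (-x * t) * g t) := by
  have hN0 : (0 : ℝ) < N := hx.trans hN
  have hq : 0 ≤ 1 - x / N := sub_nonneg.2 ((div_le_one hN0).2 hN.le)
  have h1 : (⌊t * N⌋₊ : ℝ) ≤ t * N := Nat.floor_le (by positivity)
  have h2 : t * N < ⌊t * N⌋₊ + 1 := Nat.lt_floor_add_one _
  set m := ⌊t * N⌋₊
  have hm : (0 : ℝ) ≤ m * (N : ℝ)⁻¹ := by positivity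
  have hmt : (m : ℝ) * (N : ℝ)⁻¹ ≤ t := by
    rw [← div_eq_mul_inv, div_le_iff₀ hN0]
    exact h1
  have hexp : (1 - x / N) ^ m ≤ Real.exp 1 * Real.exp (-x * t) := by
    calc (1 - x / N) ^ m ≤ (Real.exp (-(x / N))) ^ m := by
          gcongr
          exact Real.one_sub_le_exp_neg _
      _ = Real.exp (m * -(x / N)) := (Real.exp_nat_mul _ _).symm
      _ ≤ Real.exp (1 + -x * t) := by
          refine Real.exp_le_exp.2 ?_
          have h3 : x / N ≤ 1 := (div_le_one hN0).2 hN.le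
          have h4 : x * t = x / N * (t * N) := by field_simp
          have h5 : 0 < x / N := by positivity
          nlinarith
      _ = _ := Real.exp_add _ _
  have hgm := hg.1 _ hm
  rw [laplaceStep, Real.norm_of_nonneg (mul_nonneg (pow_nonneg hq _) hgm), ← mul_assoc]
  exact mul_le_mul hexp (hg.monotoneOn hm ht.le hmt) hgm (by positivity)

lemma IsBernstein.tendsto_laplaceStep {g : ℝ → ℝ} (hg : IsBernstein g) {x : ℝ} (hx : 0 < x)
    {t : ℝ} (ht : 0 < t) :
    Tendsto (fun N => laplaceStep g x N t) atTop (𝓝 (Real.exp (-x * t) * g t)) := by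
  have h1 : Tendsto (fun N : ℕ => (⌊t * N⌋₊ : ℝ) * (N : ℝ)⁻¹) atTop (𝓝 t) :=
    (tendsto_nat_floor_mul_div_atTop ht.le).comp tendsto_natCast_atTop_atTop
  refine Tendsto.mul ?_ ?_
  · have h2 := (Real.tendsto_mul_log_one_add_div_atTop (-x)).comp tendsto_natCast_atTop_atTop
    have h3 := (Real.continuous_exp.tendsto _).comp (h2.mul h1)
    refine h3.congr' ?_
    filter_upwards [tendsto_natCast_atTop_atTop.eventually_gt_atTop x] with N hN
    have hN0 : (0 : ℝ) < N := hx.trans hN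
    have hq : 0 < 1 - x / N := sub_pos.2 ((div_lt_one hN0).2 hN)
    simp only [Function.comp_apply]
    rw [show (1 : ℝ) + -x / N = 1 - x / N by ring]
    rw [show (N : ℝ) * Real.log (1 - x / N) * (⌊t * N⌋₊ * (N : ℝ)⁻¹) =
      ⌊t * N⌋₊ * Real.log (1 - x / N) by field_simp, Real.exp_nat_mul, Real.exp_log hq]
  · refine (hg.2.1 t ht.le).tendsto.comp (tendsto_nhdsWithin_iff.2 ⟨h1, ?_⟩)
    exact Eventually.of_forall fun N => mem_Ici.2 (by positivity)

lemma IsBernstein.tendsto_integral_laplaceStep {g : ℝ → ℝ} (hg : IsBernstein g) {x : ℝ}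
    (hx : 0 < x) :
    Tendsto (fun N => ∫ t in Ioi 0, laplaceStep g x N t) atTop
      (𝓝 (∫ t in Ioi 0, Real.exp (-x * t) * g t)) := by
  refine tendsto_integral_filter_of_dominated_convergence
    (fun t => Real.exp 1 * (Real.exp (-x * t) * g t))
    (Eventually.of_forall fun N => (measurable_laplaceStep g x N).aestronglyMeasurable) ?_
    ((hg.integrableOn_exp_mul hx).const_mul _) ?_
  · filter_upwards [tendsto_natCast_atTop_atTop.eventually_gt_atTop x] with N hN
    exact (ae_restrict_iff' measurableSet_Ioi).2
      (Eventually.of_forall fun t ht => hg.norm_laplaceStep_le hx hN ht)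
  · exact (ae_restrict_iff' measurableSet_Ioi).2
      (Eventually.of_forall fun t ht => hg.tendsto_laplaceStep hx ht)

lemma IsBernstein.hasSum_laplaceStep {g : ℝ → ℝ} (hg : IsBernstein g) {x : ℝ} (hx : 0 < x) {N : ℕ}
    (hN : x < N) :
    HasSum (fun m : ℕ => (1 - x / N) ^ m * g (m * (N : ℝ)⁻¹))
      (N * ∫ t in Ioi 0, laplaceStep g x N t) := by
  have hN0 : (0 : ℝ) < N := hx.trans hN
  let s : ℕ → Set ℝ := fun m => Ico (m / N) ((m + 1) / N)
  have hs : ∀ m t, t ∈ s m ↔ 0 ≤ t ∧ ⌊t * N⌋₊ = m := by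
    intro m t
    simp only [s, mem_Ico, div_le_iff₀ hN0, lt_div_iff₀ hN0]
    constructor
    · rintro ⟨h1, h2⟩
      have h3 : 0 ≤ t * N := (Nat.cast_nonneg m).trans h1
      exact ⟨nonneg_of_mul_nonneg_left h3 hN0, (Nat.floor_eq_iff h3).2 ⟨h1, h2⟩⟩
    · rintro ⟨h1, h2⟩
      exact (Nat.floor_eq_iff (by positivity)).1 h2
  have hU : ⋃ m, s m = Ici 0 := by
    ext t
    simp [hs]
  have hbk : IntegrableOn (laplaceStep g x N) (⋃ m, s m) := by
    rw [hU, integrableOn_Ici_iff_integrableOn_Ioi]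
    refine ((hg.integrableOn_exp_mul hx).const_mul (Real.exp 1)).mono'
      (measurable_laplaceStep g x N).aestronglyMeasurable ?_
    exact (ae_restrict_iff' measurableSet_Ioi).2
      (Eventually.of_forall fun t ht => hg.norm_laplaceStep_le hx hN ht)
  have hdisj : Pairwise (Function.onFun Disjoint s) := by
    intro m m' hmm
    refine Set.disjoint_left.2 fun t ht ht' => hmm ?_
    rw [← ((hs m t).1 ht).2, ((hs m' t).1 ht').2]
  have h := (hasSum_integral_iUnion (fun m => measurableSet_Ico) hdisj hbk).mul_left (N : ℝ)
  rw [hU, integral_Ici_eq_integral_Ioi] at h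
  refine h.congr_fun fun m => ?_
  have hc : ∫ t in s m, laplaceStep g x N t =
      ∫ _ in s m, (1 - x / N) ^ m * g (m * (N : ℝ)⁻¹) :=
    setIntegral_congr_fun measurableSet_Ico fun t ht => by
      simp only [laplaceStep, ((hs m t).1 ht).2]
  rw [hc, setIntegral_const, smul_eq_mul, Real.volume_real_Ico_of_le (by gcongr; simp)]
  field_simp
  ring

lemma IsBernstein.tendsto_tsum_increments {g : ℝ → ℝ} (hg : IsBernstein g) {x : ℝ} (hx : 0 < x) :
    Tendsto (fun N : ℕ => x * (g 0 + ∑' j : ℕ,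
      (g (((j + 1 : ℕ) : ℝ) * (N : ℝ)⁻¹) - g (j * (N : ℝ)⁻¹)) * (1 - x / N) ^ j)) atTop
      (𝓝 (x ^ 2 * ∫ t in Ioi 0, Real.exp (-x * t) * g t)) := by
  have hI := hg.tendsto_integral_laplaceStep hx
  have hq : Tendsto (fun N : ℕ => 1 - x / (N : ℝ)) atTop (𝓝 1) := by
    simpa using (tendsto_const_div_atTop_nhds_zero_nat x).const_sub 1
  have h := ((((hI.const_mul x).sub_const (g 0)).div hq one_ne_zero).const_add (g 0)).const_mul x
  have e : x * (g 0 + (x * (∫ t in Ioi 0, Real.exp (-x * t) * g t) - g 0) / 1) =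
      x ^ 2 * ∫ t in Ioi 0, Real.exp (-x * t) * g t := by ring
  rw [e] at h
  refine h.congr' ?_
  filter_upwards [tendsto_natCast_atTop_atTop.eventually_gt_atTop x] with N hN
  have hN0 : (0 : ℝ) < N := hx.trans hN
  have hq0 : 1 - x / N ≠ 0 := (sub_pos.2 ((div_lt_one hN0).2 hN)).ne'
  have hA := hg.hasSum_laplaceStep hx hN
  set I := ∫ t in Ioi 0, laplaceStep g x N t
  have hA' := (((hasSum_nat_add_iff' 1).2 hA).div_const (1 - x / N)).sub hA
  have e2 : (N * I - ∑ i ∈ Finset.range 1, (1 - x / (N : ℝ)) ^ i * g (i * (N : ℝ)⁻¹)) /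
      (1 - x / N) - N * I = (x * I - g 0) / (1 - x / N) := by
    rw [Finset.sum_range_one, eq_div_iff hq0, sub_mul, div_mul_cancel₀ _ hq0]
    simp
    field_simp
    ring
  rw [e2] at hA'
  have hB : HasSum (fun j : ℕ => (g (((j + 1 : ℕ) : ℝ) * (N : ℝ)⁻¹) - g (j * (N : ℝ)⁻¹)) *
      (1 - x / N) ^ j) ((x * I - g 0) / (1 - x / N)) := by
    refine hA'.congr_fun fun j => ?_
    rw [pow_succ, mul_right_comm, mul_div_cancel_right₀ _ hq0]
    ring
  rw [hB.tsum_eq]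
  rfl

lemma mem_cbfCone_of_tendsto_tendsto {G : ℕ → ℕ → Ioi (0 : ℝ) → ℝ} {S : ℕ → Ioi (0 : ℝ) → ℝ}
    {f : Ioi (0 : ℝ) → ℝ} (hG : ∀ᶠ N in atTop, ∀ n, G N n ∈ cbfCone)
    (hS : ∀ x, ∀ᶠ N in atTop, Tendsto (fun n => G N n x) atTop (𝓝 (S N x)))
    (hf : ∀ x, Tendsto (fun N => S N x) atTop (𝓝 (f x))) : f ∈ cbfCone := by
  rw [← SetLike.mem_coe, ← isClosed_cbfCone.closure_eq, mem_closure_iff]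
  intro U hU hfU
  obtain ⟨I, u, hu, hIU⟩ := isOpen_pi_iff.1 hU f hfU
  have h1 : ∀ᶠ N in atTop, ∀ x ∈ I, S N x ∈ u x := (Filter.eventually_all_finset I).2
    fun x hx => (hf x).eventually ((hu x hx).1.mem_nhds (hu x hx).2)
  have h2 : ∀ᶠ N in atTop, ∀ x ∈ I, Tendsto (fun n => G N n x) atTop (𝓝 (S N x)) :=
    (Filter.eventually_all_finset I).2 fun x _ => hS x
  obtain ⟨N, hN, hN1, hN2⟩ := (hG.and (h1.and h2)).exists
  have h3 : ∀ᶠ n in atTop, ∀ x ∈ I, G N n x ∈ u x := (Filter.eventually_all_finset I).2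
    fun x hx => (hN2 x hx).eventually ((hu x hx).1.mem_nhds (hN1 x hx))
  obtain ⟨n, hn⟩ := h3.exists
  exact ⟨G N n, hIU hn, hN n⟩

lemma mem_cbfCone_of_isCBF {f : ℝ → ℝ} (hf : IsCBF f) : (fun x : Ioi (0 : ℝ) => f x) ∈ cbfCone := by
  obtain ⟨g, hg, hfg⟩ := hf
  have hdiff : ∀ N : ℕ, ∃ d : ℕ → ℕ → ℝ, 0 < N →
      (∀ k, d 0 k = g (((k + 1 : ℕ) : ℝ) * (N : ℝ)⁻¹) - g (k * (N : ℝ)⁻¹)) ∧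
      (∀ m k, d (m + 1) k = d m k - d m (k + 1)) ∧ ∀ m k, 0 ≤ d m k := by
    intro N
    by_cases hN : 0 < N
    · obtain ⟨d, hd⟩ := hg.exists_differences (h := (N : ℝ)⁻¹) (by positivity)
      exact ⟨d, fun _ => hd⟩
    · exact ⟨fun _ _ => 0, fun h => absurd h hN⟩
  choose d hd using hdiff
  refine mem_cbfCone_of_tendsto_tendsto
    (G := fun N n x => g 0 * x + ∑ k ∈ Finset.range (n + 1), (n.choose k * d N (n - k) k) *
      (x / ((1 - k / n) + (k / n / N) * x)))
    (S := fun N x => x * (g 0 + ∑' j : ℕ, d N 0 j * (1 - x / N) ^ j)) ?_ ?_ ?_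
  · filter_upwards [eventually_gt_atTop 0] with N hN n
    obtain ⟨-, -, hd0⟩ := hd N hN
    refine add_mem (const_mul_mem_cbfCone coe_mem_cbfCone (hg.1 0 le_rfl)) ?_
    have hsum : ∑ k ∈ Finset.range (n + 1), (fun x : Ioi (0 : ℝ) => (n.choose k * d N (n - k) k) *
        ((x : ℝ) / ((1 - k / n) + (k / n / N) * x))) ∈ cbfCone := by
      refine sum_mem fun k hk => const_mul_mem_cbfCone (div_affine_mem_cbfCone ?_ ?_ ?_)
        (mul_nonneg (Nat.cast_nonneg _) (hd0 _ _))
      all_goals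
        have hN' : (0 : ℝ) < N := by exact_mod_cast hN
        have h0 : 0 ≤ (k : ℝ) / n := by positivity
        have h1 : (k : ℝ) / n ≤ 1 := div_le_one_of_le₀
          (by exact_mod_cast Nat.lt_succ_iff.1 (Finset.mem_range.1 hk)) (Nat.cast_nonneg _)
      · linarith
      · positivity
      · rcases h1.lt_or_eq with h | h
        · have : 0 ≤ (k : ℝ) / n / N := by positivity
          linarith
        · rw [h]
          simpa using hN
    convert hsum using 1
    funext x
    simp
  · intro x
    have hx : (0 : ℝ) < x := x.2
    filter_upwards [tendsto_natCast_atTop_atTop.eventually_gt_atTop (x : ℝ)] with N hN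
    have hN0 : (0 : ℝ) < N := hx.trans hN
    obtain ⟨-, hd1, hd0⟩ := hd N (by exact_mod_cast hN0)
    have h := tendsto_sum_choose_mul_div hd1 hd0 (sub_pos.2 ((div_lt_one hN0).2 hN))
      (sub_lt_self 1 (div_pos hx hN0))
    refine ((h.const_add (g 0)).const_mul (x : ℝ)).congr fun n => ?_
    rw [mul_add, mul_comm, Finset.mul_sum]
    congr 1
    refine Finset.sum_congr rfl fun k _ => ?_
    rw [mul_left_comm, ← mul_div_assoc, mul_one]
    ring_nf
  · intro x
    have hx : (0 : ℝ) < x := x.2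
    rw [hfg x hx]
    refine (hg.tendsto_tsum_increments hx).congr' ?_
    filter_upwards [eventually_gt_atTop 0] with N hN
    simp_rw [(hd N hN).1]

/-- The kernel `x ↦ x / (x (1 - u) + u)`, `u ∈ [0,1]`: a compactified parametrization of the
functions `x ↦ x / (x + s)`, `s = u / (1 - u) ∈ [0,∞]`. -/
noncomputable def compactKernel (x u : ℝ) : ℝ := x / (x * (1 - u) + u)

lemma compactKernel_denom_pos {x u : ℝ} (hx : 0 < x) (hu0 : 0 ≤ u) (hu1 : u ≤ 1) :
    0 < x * (1 - u) + u := by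
  rcases hu0.eq_or_lt with rfl | hu
  · simpa using hx
  · have := mul_nonneg hx.le (sub_nonneg.2 hu1)
    linarith

lemma continuous_compactKernel {x : ℝ} (hx : 0 < x) :
    Continuous fun u : unitInterval => compactKernel x u :=
  continuous_const.div (by fun_prop) fun u => (compactKernel_denom_pos hx u.2.1 u.2.2).ne'

lemma integrable_compactKernel {x : ℝ} (hx : 0 < x) (μ : Measure unitInterval)
    [IsFiniteMeasure μ] : Integrable (fun u : unitInterval => compactKernel x u) μ :=
  (BoundedContinuousFunction.mkOfCompact ⟨_, continuous_compactKernel hx⟩).integrable μ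

lemma exists_measure_of_mem_span {f : Ioi (0 : ℝ) → ℝ}
    (hf : f ∈ Submodule.span ℝ≥0 (range cbfKernel)) :
    ∃ μ : FiniteMeasure unitInterval, ∀ x : Ioi (0 : ℝ),
      f x = ∫ u : unitInterval, compactKernel x u ∂(μ : Measure unitInterval) := by
  induction hf using Submodule.span_induction with
  | mem g hg =>
    obtain ⟨s, rfl⟩ := hg
    have hs := s.2.out
    have hu : (s : ℝ) / (1 + s) ∈ unitInterval :=
      ⟨by positivity, (div_le_one (by positivity)).2 (by linarith)⟩
    refine ⟨((1 + (s : ℝ))⁻¹).toNNReal •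
      (ProbabilityMeasure.toFiniteMeasure ⟨Measure.dirac (⟨_, hu⟩ : unitInterval), inferInstance⟩),
        fun x => ?_⟩
    have hx := x.2.out
    rw [FiniteMeasure.toMeasure_smul, integral_smul_nnreal_measure]
    simp only [ProbabilityMeasure.toFiniteMeasure, FiniteMeasure.toMeasure_mk,
      ProbabilityMeasure.coe_mk, integral_dirac, compactKernel, cbfKernel, NNReal.smul_def,
      Real.coe_toNNReal _ (by positivity : 0 ≤ (1 + (s : ℝ))⁻¹), smul_eq_mul]
    have h1 : (x : ℝ) * (1 - s / (1 + s)) + s / (1 + s) = (x + s) / (1 + s) := by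
      field_simp; ring
    rw [h1]
    field_simp
  | zero => exact ⟨0, fun x => by simp⟩
  | add f g _ _ hf hg =>
    obtain ⟨μ, hμ⟩ := hf
    obtain ⟨ν, hν⟩ := hg
    refine ⟨μ + ν, fun x => ?_⟩
    rw [FiniteMeasure.toMeasure_add, integral_add_measure (integrable_compactKernel x.2 _)
      (integrable_compactKernel x.2 _), ← hμ, ← hν]
    rfl
  | smul c f _ hf =>
    obtain ⟨μ, hμ⟩ := hf
    refine ⟨c • μ, fun x => ?_⟩
    rw [FiniteMeasure.toMeasure_smul, integral_smul_nnreal_measure, ← hμ]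
    rfl

lemma isCompact_integral_compactKernel (R : ℝ) :
    IsCompact ((fun (p : ℝ × ProbabilityMeasure unitInterval) (x : Ioi (0 : ℝ)) =>
      p.1 * ∫ u : unitInterval, compactKernel x u ∂(p.2 : Measure unitInterval)) ''
        (Icc 0 R ×ˢ univ)) := by
  refine (isCompact_Icc.prod isCompact_univ).image (continuous_pi fun x => ?_)
  refine continuous_fst.mul ?_
  exact (ProbabilityMeasure.continuous_integral_continuousMap
    (⟨_, continuous_compactKernel x.2⟩ : C(unitInterval, ℝ))).comp continuous_snd

/-- Every element of the cone is an integral of the kernels `x / (x (1 - u) + u)` against a finite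
measure on `[0,1]`. -/
lemma exists_measure_of_mem_cbfCone {f : Ioi (0 : ℝ) → ℝ} (hf : f ∈ cbfCone) :
    ∃ μ : Measure unitInterval, IsFiniteMeasure μ ∧ ∀ x : Ioi (0 : ℝ),
      f x = ∫ u : unitInterval, compactKernel x u ∂μ := by
  set o : Ioi (0 : ℝ) := ⟨1, mem_Ioi.2 one_pos⟩
  set R : ℝ := f o + 1
  have hU : IsOpen {g : Ioi (0 : ℝ) → ℝ | g o < R} :=
    isOpen_lt (continuous_apply o) continuous_const
  have hfU : f ∈ {g : Ioi (0 : ℝ) → ℝ | g o < R} := by simp [R]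
  have hmem := hU.inter_closure ⟨hfU, hf⟩
  suffices hsub : {g : Ioi (0 : ℝ) → ℝ | g o < R} ∩ Submodule.span ℝ≥0 (range cbfKernel) ⊆
      (fun (p : ℝ × ProbabilityMeasure unitInterval) (x : Ioi (0 : ℝ)) =>
        p.1 * ∫ u : unitInterval, compactKernel x u ∂(p.2 : Measure unitInterval)) ''
          (Icc 0 R ×ˢ univ) by
    obtain ⟨⟨r, P⟩, ⟨⟨hr0, -⟩, -⟩, hP⟩ := closure_minimal hsub
      (isCompact_integral_compactKernel R).isClosed hmem
    refine ⟨r.toNNReal • (P : Measure unitInterval), inferInstance, fun x => ?_⟩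
    rw [integral_smul_nnreal_measure, ← hP, NNReal.smul_def, Real.coe_toNNReal r hr0,
      smul_eq_mul]
  rintro g ⟨hgR, hg⟩
  obtain ⟨μ, hμ⟩ := exists_measure_of_mem_span hg
  have h1 : ∀ x : Ioi (0 : ℝ), g x = μ.mass * ∫ u : unitInterval, compactKernel x u
      ∂(μ.normalize : Measure unitInterval) := by
    intro x
    rw [hμ x]
    conv_lhs => rw [μ.self_eq_mass_smul_normalize]
    rw [FiniteMeasure.toMeasure_smul, integral_smul_nnreal_measure]
    rfl
  have h2 : g o = μ.mass := by
    rw [h1 o]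
    simp [compactKernel, o]
  refine ⟨(μ.mass, μ.normalize), ⟨⟨NNReal.coe_nonneg _, ?_⟩, mem_univ _⟩, funext fun x => ?_⟩
  · exact h2 ▸ (le_of_lt hgR)
  · exact (h1 x).symm

lemma iteratedDerivWithin_eq_of_hasDerivAt {H : ℕ → ℝ → ℝ}
    (hH : ∀ n, ∀ t, 0 < t → HasDerivAt (H n) (H (n + 1) t) t) (n : ℕ) :
    EqOn (iteratedDerivWithin n (H 0) (Ioi 0)) (H n) (Ioi 0) := by
  induction n with
  | zero => intro t _; simp
  | succ n ih =>
    intro t ht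
    rw [iteratedDerivWithin_succ, derivWithin_congr ih (ih ht)]
    exact (hH n t ht).hasDerivWithinAt.derivWithin (isOpen_Ioi.uniqueDiffWithinAt ht)

lemma isBernstein_of_hasDerivAt {H : ℕ → ℝ → ℝ} (h0 : ∀ t, 0 ≤ t → 0 ≤ H 0 t)
    (hc : ContinuousOn (H 0) (Ici 0))
    (hH : ∀ n, ∀ t, 0 < t → HasDerivAt (H n) (H (n + 1) t) t)
    (hs : ∀ n, ∀ t, 0 < t → 0 ≤ (-1 : ℝ) ^ n * H (n + 1) t) : IsBernstein (H 0) := by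
  refine ⟨h0, hc, contDiffOn_of_differentiableOn_deriv fun m _ => ?_, fun n hn t ht => ?_⟩
  · refine DifferentiableOn.congr (fun t ht => ?_) (iteratedDerivWithin_eq_of_hasDerivAt hH m)
    exact (hH m t ht).differentiableAt.differentiableWithinAt
  · rw [iteratedDerivWithin_eq_of_hasDerivAt hH n ht]
    obtain ⟨m, rfl⟩ := Nat.exists_eq_add_of_le' hn
    exact hs m t ht

/-- The Bernstein function whose Laplace transform is `compactKernel x u / x ^ 2`, together with
its derivatives in `t`. -/
noncomputable def bernsteinKernel (n : ℕ) (t u : ℝ) : ℝ :=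
  match n with
  | 0 => if u = 1 then 1 else if u = 0 then t else (1 - Real.exp (-(t * (u / (1 - u))))) / u
  | n + 1 => if u = 1 then 0 else
      (1 + u / (1 - u)) * (-(u / (1 - u))) ^ n * Real.exp (-(t * (u / (1 - u))))

lemma measurable_bernsteinKernel (n : ℕ) :
    Measurable fun p : ℝ × ℝ => bernsteinKernel n p.1 p.2 := by
  cases n with
  | zero =>
    refine Measurable.ite (measurable_snd (measurableSet_singleton 1)) measurable_const
      (Measurable.ite (measurable_snd (measurableSet_singleton 0)) measurable_fst ?_)
    fun_prop
  | succ n =>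
    refine Measurable.ite (measurable_snd (measurableSet_singleton 1)) measurable_const ?_
    fun_prop

lemma measurable_bernsteinKernel_right (n : ℕ) (t : ℝ) :
    Measurable fun u : unitInterval => bernsteinKernel n t u :=
  (measurable_bernsteinKernel n).comp (measurable_const.prodMk measurable_subtype_coe)

lemma hasDerivAt_bernsteinKernel (n : ℕ) (t u : ℝ) :
    HasDerivAt (fun t => bernsteinKernel n t u) (bernsteinKernel (n + 1) t u) t := by
  have hexp : HasDerivAt (fun t => Real.exp (-(t * (u / (1 - u)))))
      (Real.exp (-(t * (u / (1 - u)))) * -(1 * (u / (1 - u)))) t :=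
    ((hasDerivAt_id t).mul_const _).neg.exp
  by_cases h1 : u = 1
  · cases n <;> simpa [bernsteinKernel, h1] using hasDerivAt_const t _
  cases n with
  | zero =>
    by_cases h0 : u = 0
    · simpa [bernsteinKernel, h0] using hasDerivAt_id' t
    · simp only [bernsteinKernel, h1, h0, if_false]
      refine ((hexp.const_sub 1).div_const u).congr_deriv ?_
      have : 1 - u ≠ 0 := sub_ne_zero.2 (Ne.symm h1)
      field_simp
      ring
  | succ n =>
    simp only [bernsteinKernel, h1, if_false]
    refine (hexp.const_mul _).congr_deriv ?_
    ring

lemma bernsteinKernel_zero_mem {t u : ℝ} (ht : 0 ≤ t) (hu0 : 0 ≤ u) (hu1 : u ≤ 1) :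
    bernsteinKernel 0 t u ∈ Icc 0 (1 + t) := by
  simp only [bernsteinKernel]
  split_ifs with h1 h0
  · exact ⟨zero_le_one, by linarith⟩
  · exact ⟨ht, by linarith⟩
  · have hu : 0 < u := lt_of_le_of_ne hu0 (Ne.symm h0)
    have hu' : 0 < 1 - u := sub_pos.2 (lt_of_le_of_ne hu1 h1)
    set E := Real.exp (-(t * (u / (1 - u))))
    have hE1 : E ≤ 1 := Real.exp_le_one_iff.2 (by simp only [Left.neg_nonpos_iff]; positivity)
    have hE0 : 0 < E := Real.exp_pos _
    have hE2 : (1 - u) * (1 - E) ≤ t * u := by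
      have h := Real.add_one_le_exp (-(t * (u / (1 - u))))
      have h' : 1 - E ≤ t * (u / (1 - u)) := by linarith
      calc (1 - u) * (1 - E) ≤ (1 - u) * (t * (u / (1 - u))) :=
            mul_le_mul_of_nonneg_left h' hu'.le
        _ = t * u := by field_simp
    refine ⟨div_nonneg (by linarith) hu0, (div_le_iff₀ hu).2 ?_⟩
    nlinarith

lemma abs_bernsteinKernel_succ_le (n : ℕ) {t₀ t u : ℝ} (ht₀ : 0 < t₀) (ht : t₀ ≤ t)
    (hu0 : 0 ≤ u) (hu1 : u ≤ 1) :
    |bernsteinKernel (n + 1) t u| ≤ n.factorial / t₀ ^ n + (n + 1).factorial / t₀ ^ (n + 1) := by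
  simp only [bernsteinKernel]
  split_ifs with h1
  · rw [abs_zero]; positivity
  · set s := u / (1 - u)
    have hs : 0 ≤ s := div_nonneg hu0 (sub_nonneg.2 hu1)
    have key : ∀ m : ℕ, s ^ m * Real.exp (-(t * s)) ≤ m.factorial / t₀ ^ m := by
      intro m
      have h2 := Real.pow_div_factorial_le_exp (t₀ * s) (by positivity) m
      have h3 : Real.exp (-(t * s)) ≤ Real.exp (-(t₀ * s)) :=
        Real.exp_le_exp.2 (neg_le_neg (mul_le_mul_of_nonneg_right ht hs))
      have h4 : 0 < Real.exp (t₀ * s) := Real.exp_pos _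
      rw [Real.exp_neg (t₀ * s)] at h3
      calc s ^ m * Real.exp (-(t * s)) ≤ s ^ m * (Real.exp (t₀ * s))⁻¹ :=
            mul_le_mul_of_nonneg_left h3 (by positivity)
        _ ≤ m.factorial / t₀ ^ m := by
            rw [mul_pow, div_le_iff₀ (by positivity)] at h2
            rw [← div_eq_mul_inv, div_le_div_iff₀ h4 (by positivity)]
            linarith
    have habs : |(1 + s) * (-s) ^ n * Real.exp (-(t * s))| =
        s ^ n * Real.exp (-(t * s)) + s ^ (n + 1) * Real.exp (-(t * s)) := by
      rw [abs_mul, abs_mul, abs_pow, abs_neg, abs_of_nonneg hs, Real.abs_exp,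
        abs_of_nonneg (by linarith : 0 ≤ 1 + s)]
      ring
    rw [habs]
    exact add_le_add (key n) (key (n + 1))

lemma neg_one_pow_mul_bernsteinKernel_succ_nonneg (n : ℕ) (t : ℝ) {u : ℝ} (hu0 : 0 ≤ u)
    (hu1 : u ≤ 1) : 0 ≤ (-1 : ℝ) ^ n * bernsteinKernel (n + 1) t u := by
  simp only [bernsteinKernel]
  split_ifs with h1
  · simp
  · have hs : 0 ≤ u / (1 - u) := div_nonneg hu0 (sub_nonneg.2 hu1)
    have h2 : (-1 : ℝ) ^ n * (-(u / (1 - u))) ^ n = (u / (1 - u)) ^ n := by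
      rw [← mul_pow]; ring
    calc (0 : ℝ) ≤ (1 + u / (1 - u)) * (u / (1 - u)) ^ n *
          Real.exp (-(t * (u / (1 - u)))) := by positivity
      _ = _ := by rw [← h2]; ring

lemma sq_mul_integral_bernsteinKernel {x u : ℝ} (hx : 0 < x) (hu0 : 0 ≤ u) (hu1 : u ≤ 1) :
    x ^ 2 * ∫ t in Ioi (0 : ℝ), Real.exp (-x * t) * bernsteinKernel 0 t u =
      compactKernel x u := by
  have hexp : ∀ a : ℝ, 0 < a → ∫ t in Ioi (0 : ℝ), Real.exp (-a * t) = 1 / a := by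
    intro a ha
    rw [integral_exp_mul_Ioi (neg_lt_zero.2 ha)]
    simp
  simp only [bernsteinKernel, compactKernel]
  split_ifs with h1 h0
  · simp only [mul_one, hexp x hx, h1]
    field_simp
    simp
  · have h := Real.integral_rpow_mul_exp_neg_mul_Ioi (a := 2) two_pos hx
    have h' : ∫ t in Ioi (0 : ℝ), Real.exp (-x * t) * t = (1 / x) ^ 2 := by
      rw [show (2 : ℝ) = (1 : ℕ) + 1 by norm_num, Real.Gamma_nat_eq_factorial] at h
      norm_num at h
      rw [one_div, inv_pow, ← h]
      exact integral_congr_ae (Eventually.of_forall fun t => by simp [mul_comm])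
    rw [h', h0]
    field_simp
    simp
  · have hu : 0 < u := lt_of_le_of_ne hu0 (Ne.symm h0)
    have hu' : 0 < 1 - u := sub_pos.2 (lt_of_le_of_ne hu1 h1)
    have hs : 0 < u / (1 - u) := div_pos hu hu'
    have hbk : ∀ a : ℝ, 0 < a → IntegrableOn (fun t => Real.exp (-a * t)) (Ioi 0) :=
      fun a ha => integrableOn_exp_mul_Ioi (neg_lt_zero.2 ha) 0
    have heq : ∀ t : ℝ, Real.exp (-x * t) * ((1 - Real.exp (-(t * (u / (1 - u))))) / u) =
        (Real.exp (-x * t) - Real.exp (-(x + u / (1 - u)) * t)) * (1 / u) := by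
      intro t
      rw [show -(x + u / (1 - u)) * t = -x * t + -(t * (u / (1 - u))) by ring, Real.exp_add]
      ring
    simp only [heq]
    rw [integral_mul_const, integral_sub (hbk x hx) (hbk _ (add_pos hx hs)), hexp x hx,
      hexp _ (add_pos hx hs)]
    have := compactKernel_denom_pos hx hu0 hu1
    rw [show x + u / (1 - u) = (x * (1 - u) + u) / (1 - u) by field_simp]
    field_simp
    ring

lemma isCBF_of_integral_compactKernel (μ : Measure unitInterval) [IsFiniteMeasure μ] {f : ℝ → ℝ}
    (hf : ∀ x, 0 < x → f x = ∫ u : unitInterval, compactKernel x u ∂μ) : IsCBF f := by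
  have hbk0 : ∀ t, 0 ≤ t → Integrable (fun u : unitInterval => bernsteinKernel 0 t u) μ :=
    fun t ht => (integrable_const (1 + t)).mono'
      (measurable_bernsteinKernel_right 0 t).aestronglyMeasurable
      (Eventually.of_forall fun u => by
        have h := bernsteinKernel_zero_mem ht u.2.1 u.2.2
        rw [Real.norm_of_nonneg h.1]; exact h.2)
  have hbk : ∀ n t, 0 < t → Integrable (fun u : unitInterval => bernsteinKernel n t u) μ := by
    intro n t ht
    cases n with
    | zero => exact hbk0 t ht.le
    | succ n =>
      exact (integrable_const _).mono'
        (measurable_bernsteinKernel_right _ t).aestronglyMeasurable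
        (Eventually.of_forall fun u => abs_bernsteinKernel_succ_le n ht le_rfl u.2.1 u.2.2)
  refine ⟨fun t => ∫ u : unitInterval, bernsteinKernel 0 t u ∂μ,
    isBernstein_of_hasDerivAt (H := fun n t => ∫ u : unitInterval, bernsteinKernel n t u ∂μ)
      ?_ ?_ ?_ ?_, ?_⟩
  · exact fun t ht => integral_nonneg fun u => (bernsteinKernel_zero_mem ht u.2.1 u.2.2).1
  · intro t ht
    refine continuousWithinAt_of_dominated (bound := fun _ => 1 + (t + 1))
      (Eventually.of_forall fun t => (measurable_bernsteinKernel_right 0 t).aestronglyMeasurable)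
      ?_ (integrable_const _)
      (Eventually.of_forall fun u =>
        (hasDerivAt_bernsteinKernel 0 t u).continuousAt.continuousWithinAt)
    filter_upwards [self_mem_nhdsWithin, mem_nhdsWithin_of_mem_nhds (Iio_mem_nhds (lt_add_one t))]
      with y hy0 hy1
    refine Eventually.of_forall fun u => ?_
    have h := bernsteinKernel_zero_mem hy0 u.2.1 u.2.2
    rw [Real.norm_of_nonneg h.1]
    exact h.2.trans (add_le_add_right (le_of_lt hy1) 1)
  · intro n t ht
    exact (hasDerivAt_integral_of_dominated_loc_of_deriv_le (Ioi_mem_nhds (half_lt_self ht))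
      (Eventually.of_forall fun t => (measurable_bernsteinKernel_right n t).aestronglyMeasurable)
      (hbk n t ht) (measurable_bernsteinKernel_right (n + 1) t).aestronglyMeasurable
      (Eventually.of_forall fun u y hy =>
        abs_bernsteinKernel_succ_le n (half_pos ht) (le_of_lt hy) u.2.1 u.2.2)
      (integrable_const _)
      (Eventually.of_forall fun u y _ => hasDerivAt_bernsteinKernel n y u)).2
  · intro n t _
    rw [← integral_const_mul]
    exact integral_nonneg fun u =>
      neg_one_pow_mul_bernsteinKernel_succ_nonneg n t u.2.1 u.2.2
  · intro x hx
    have hbound : IntegrableOn (fun t : ℝ => Real.exp (-x * t) * (1 + t)) (Ioi 0) := by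
      have h1 := integrableOn_exp_mul_Ioi (neg_lt_zero.2 hx) 0
      have h2 := integrableOn_rpow_mul_exp_neg_mul_rpow (s := 1) (p := 1) (by norm_num) one_pos hx
      refine (h1.add h2).congr (Eventually.of_forall fun t => ?_)
      simp only [Pi.add_apply, Real.rpow_one]
      ring
    have hprod : Integrable (Function.uncurry fun (t : ℝ) (u : unitInterval) =>
        Real.exp (-x * t) * bernsteinKernel 0 t u) ((volume.restrict (Ioi 0)).prod μ) := by
      refine (hbound.comp_fst μ).mono' ?_ ?_
      · refine Measurable.aestronglyMeasurable ?_
        refine Measurable.mul (by fun_prop) ?_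
        exact (measurable_bernsteinKernel 0).comp
          (measurable_fst.prodMk (measurable_subtype_coe.comp measurable_snd))
      · have hae : ∀ᵐ t ∂(volume.restrict (Ioi (0 : ℝ))), 0 < t :=
          ae_restrict_mem measurableSet_Ioi
        filter_upwards [Measure.quasiMeasurePreserving_fst.ae hae] with p hp
        have h := bernsteinKernel_zero_mem (le_of_lt hp) p.2.2.1 p.2.2.2
        simp only [Function.uncurry]
        rw [Real.norm_of_nonneg (mul_nonneg (Real.exp_nonneg _) h.1)]
        exact mul_le_mul_of_nonneg_left h.2 (Real.exp_nonneg _)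
    simp only [← integral_const_mul (μ := μ)]
    rw [integral_integral_swap hprod, ← integral_const_mul, hf x hx]
    exact integral_congr_ae (Eventually.of_forall fun u =>
      (sq_mul_integral_bernsteinKernel hx u.2.1 u.2.2).symm)

lemma isCBF_of_mem_cbfCone {f : ℝ → ℝ} (hf : (fun x : Ioi (0 : ℝ) => f x) ∈ cbfCone) :
    IsCBF f := by
  obtain ⟨μ, _, h⟩ := exists_measure_of_mem_cbfCone hf
  exact isCBF_of_integral_compactKernel μ fun x hx => h ⟨x, hx⟩

/-- if `f` is a complete Bernstein function and `0 ≤ α ≤ 1`,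
then `p ↦ f(p)^α` is a complete Bernstein function. -/
theorem cbf_rpow (f : ℝ → ℝ) (hf : IsCBF f) (α : ℝ) (hα0 : 0 ≤ α) (hα1 : α ≤ 1) :
    IsCBF (fun p => f p ^ α) :=
  isCBF_of_mem_cbfCone (rpow_mem_cbfCone (mem_cbfCone_of_isCBF hf) hα0 hα1)
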